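/- arXiv:2112.03467 — 2 statements merged into one kernel-verified Lean document; each statement's English description precedes it below -/
import Mathlib

section
/- Let σ_1,...,σ_L be fixed activation functions with σ_i being ρ_i-Lipschitz and σ_i(0)=0. Let s_i be a bound on the spectral norm of A_i and b_i a bound on ‖A_i^T‖_{2,1} for i = 1,...,L. Let Z ∈ C^{n×d} be a fixed data matrix. Then for any ε > 0, ln N(F, ε, ‖·‖_2) ≤ (‖Z‖_2² ln(4W²)/ε²) · (∏_{j=1}^L s_j² ρ_j²) · (Σ_{i=1}^L (b_i/s_i)^{2/3})³, where F := {F_A(Z^T) : A = (A_1,...,A_L), ‖A_i‖_σ ≤ s_i, ‖A_i^T‖_{2,1} ≤ b_i} is the family of network outputs and W = max{d_0, d_1, ..., d_L} is the maximal layer dimension. -/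
open Finset ENNReal NNReal

/-- Covering number of a set `S` w.r.t. a distance function `d` at scale `ε`. -/
noncomputable def coveringNumber {E : Type*} (d : E → E → ℝ) (S : Set E) (ε : ℝ) : ℝ≥0∞ :=
  ⨅ (C : Finset E) (_ : ∀ x ∈ S, ∃ c ∈ C, d x c ≤ ε), (C.card : ℝ≥0∞)

/-- Frobenius (entrywise l₂) norm of a complex matrix. -/
noncomputable def frob {m k : ℕ} (A : Matrix (Fin m) (Fin k) ℂ) : ℝ :=
  Real.sqrt (∑ i, ∑ j, ‖A i j‖ ^ 2)

/-- Frobenius distance between two complex matrices. -/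
noncomputable def frobDist {n m : ℕ} (X Y : Matrix (Fin n) (Fin m) ℂ) : ℝ :=
  frob (X - Y)

/-- Spectral norm of a complex matrix: `sup_{‖v‖₂ = 1} ‖Av‖₂`. -/
noncomputable def specNorm {m k : ℕ} (A : Matrix (Fin m) (Fin k) ℂ) : ℝ :=
  sSup {r : ℝ | ∃ v : Fin k → ℂ,
    Real.sqrt (∑ j, ‖v j‖ ^ 2) = 1 ∧ r = Real.sqrt (∑ i, ‖A.mulVec v i‖ ^ 2)}

/-- `‖Aᵀ‖_{2,1}`: the l₁ norm of the vector of l₂ norms of the rows of `A`. -/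
noncomputable def norm21T {m k : ℕ} (A : Matrix (Fin m) (Fin k) ℂ) : ℝ :=
  ∑ i, Real.sqrt (∑ j, ‖A i j‖ ^ 2)

/-- The output of the first `k` layers of a complex-valued network applied to a
data matrix (each column is one data point): `σ_k(A_k σ_{k-1}(⋯ σ_1(A_1 X)))`. -/
noncomputable def matNetOut (dims : ℕ → ℕ) (n : ℕ)
    (σ : ∀ i : ℕ, Matrix (Fin (dims (i + 1))) (Fin n) ℂ → Matrix (Fin (dims (i + 1))) (Fin n) ℂ)
    (A : ∀ i : ℕ, Matrix (Fin (dims (i + 1))) (Fin (dims i)) ℂ) :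
    (k : ℕ) → Matrix (Fin (dims 0)) (Fin n) ℂ → Matrix (Fin (dims k)) (Fin n) ℂ
  | 0 => fun X => X
  | (k + 1) => fun X => σ k ((A k) * (matNetOut dims n σ A k X))

theorem exists_root_of_unity_re_ge {p : ℕ} (hp : 0 < p) (z : ℂ) :
    ∃ j : Fin p, Real.cos (Real.pi / p) * ‖z‖ ≤
      (Complex.exp ((2 * Real.pi * (j : ℕ) / p : ℝ) * Complex.I) * z).re := by
  have hp' : (0 : ℝ) < p := by exact_mod_cast hp
  have hπ := Real.pi_pos
  set θ := z.arg with hθ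
  set r : ℤ := round (-θ * p / (2 * Real.pi)) with hr
  have hr1 := abs_sub_round (-θ * p / (2 * Real.pi))
  have hpz : (p : ℤ) ≠ 0 := by exact_mod_cast hp.ne'
  have hmod0 := Int.emod_nonneg r hpz
  have hmodlt := Int.emod_lt_of_pos r (by exact_mod_cast hp : (0 : ℤ) < p)
  refine ⟨⟨(r % p).toNat, by omega⟩, ?_⟩
  have hj : (((r % p).toNat : ℕ) : ℝ) = r - p * (r / p : ℤ) := by
    have h1 : (((r % p).toNat : ℕ) : ℤ) = r - p * (r / p) := by
      rw [Int.toNat_of_nonneg hmod0, Int.emod_def]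
    exact_mod_cast h1
  have hre : (Complex.exp ((2 * Real.pi * ((r % p).toNat : ℕ) / p : ℝ) * Complex.I) * z).re
      = ‖z‖ * Real.cos (2 * Real.pi * r / p + θ) := by
    conv_lhs => rw [← Complex.norm_mul_exp_arg_mul_I z]
    rw [mul_left_comm, ← Complex.exp_add, ← add_mul, ← Complex.ofReal_add, Complex.re_ofReal_mul,
      Complex.exp_ofReal_mul_I_re, hj]
    congr 1
    rw [← Real.cos_sub_int_mul_two_pi (2 * Real.pi * r / p + θ) (r / p : ℤ)]
    congr 1
    field_simp
    ring
  simp only [hre]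
  rw [mul_comm]
  refine mul_le_mul_of_nonneg_left ?_ (norm_nonneg z)
  have hab : |2 * Real.pi * r / p + θ| ≤ Real.pi / p := by
    have : 2 * Real.pi * r / p + θ
        = -(2 * Real.pi / p) * (-θ * p / (2 * Real.pi) - r) := by
      field_simp
      ring
    rw [this, abs_mul, abs_neg, abs_of_pos (by positivity : 0 < 2 * Real.pi / p)]
    calc 2 * Real.pi / p * |-θ * p / (2 * Real.pi) - r| ≤ 2 * Real.pi / p * (1 / 2) := by gcongr
      _ = Real.pi / p := by ring
  rw [← Real.cos_abs (2 * Real.pi * r / p + θ)]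
  refine Real.cos_le_cos_of_nonneg_of_le_pi (abs_nonneg _) ?_ hab
  exact div_le_self hπ.le (by exact_mod_cast hp)

/-- Sparse approximation in a Hilbert space: if `κ • F` lies in the closed convex hull of the
vectors `V i` of the unit ball, expressed through the support function, then a rescaled
sum of `k` of them approximates `F`. -/
theorem exists_sym_norm_sub_le {E ι : Type*} [NormedAddCommGroup E] [InnerProductSpace ℂ E]
    (V : ι → E) (hV : ∀ i, ‖V i‖ ≤ 1) (F : E) {κ : ℝ} (hκ : 0 < κ)
    (h : ∀ w : E, ∃ i, κ * (inner ℂ w F).re ≤ (inner ℂ w (V i)).re) {k : ℕ} (hk : 0 < k) :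
    ∃ t : Sym ι k,
      ‖F - ((κ * (√k + k))⁻¹ : ℂ) • ((t : Multiset ι).map V).sum‖ ≤ 1 / (κ * (1 + √k)) := by
  have key : ∀ (y : ℝ) (j : ℕ), ∃ t : Sym ι j,
      ‖((y + j * κ : ℝ) : ℂ) • F - ((t : Multiset ι).map V).sum‖ ^ 2
        ≤ y ^ 2 * ‖F‖ ^ 2 + j * (1 - κ ^ 2 * ‖F‖ ^ 2) := by
    intro y j
    induction j with
    | zero =>
      refine ⟨Sym.nil, ?_⟩
      simp [norm_smul, mul_pow]
    | succ j ih =>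
      obtain ⟨t, ht⟩ := ih
      set D := ((y + j * κ : ℝ) : ℂ) • F - ((t : Multiset ι).map V).sum with hD
      obtain ⟨i, hi⟩ := h (D + (κ : ℂ) • F)
      refine ⟨i ::ₛ t, ?_⟩
      have e1 : ((y + (j + 1 : ℕ) * κ : ℝ) : ℂ) • F
          - (((i ::ₛ t : Sym ι (j + 1)) : Multiset ι).map V).sum
          = D + ((κ : ℂ) • F - V i) := by
        simp only [Sym.coe_cons, Multiset.map_cons, Multiset.sum_cons, hD]
        push_cast
        module
      rw [e1]
      clear_value D
      rw [norm_add_sq (𝕜 := ℂ), norm_sub_sq (𝕜 := ℂ) ((κ : ℂ) • F)]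
      simp only [inner_add_left, inner_sub_right, inner_smul_left, inner_smul_right, norm_smul,
        Complex.conj_ofReal, Complex.add_re, Complex.sub_re, Complex.re_ofReal_mul,
        RCLike.re_to_complex,
        Complex.norm_real, Real.norm_eq_abs, abs_of_pos hκ] at hi ⊢
      have hFF : (inner ℂ F F : ℂ).re = ‖F‖ ^ 2 := by
        rw [inner_self_eq_norm_sq_to_K]; norm_cast
      have hv : ‖V i‖ ^ 2 ≤ 1 := pow_le_one₀ (norm_nonneg _) (hV i)
      rw [hFF] at hi
      push_cast
      nlinarith
  obtain ⟨t, ht⟩ := key (κ * √k) k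
  refine ⟨t, ?_⟩
  have hk' : (0 : ℝ) < k := by exact_mod_cast hk
  have hsk : 0 < √(k : ℝ) := Real.sqrt_pos.2 hk'
  have hsq : √(k : ℝ) ^ 2 = k := Real.sq_sqrt hk'.le
  set c : ℝ := κ * (√k + k) with hc
  have hcpos : 0 < c := by positivity
  have e2 : F - ((κ * (√k + k))⁻¹ : ℂ) • ((t : Multiset ι).map V).sum
      = ((c⁻¹ : ℝ) : ℂ) • (((κ * √k + k * κ : ℝ) : ℂ) • F - ((t : Multiset ι).map V).sum) := by
    rw [smul_sub, smul_smul, ← Complex.ofReal_mul]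
    have : c⁻¹ * (κ * √k + k * κ) = 1 := by rw [hc]; field_simp
    rw [this, hc]
    simp
  rw [e2, norm_smul, Complex.norm_real, Real.norm_eq_abs, abs_of_pos (inv_pos.2 hcpos)]
  have h3 : ‖((κ * √k + k * κ : ℝ) : ℂ) • F - ((t : Multiset ι).map V).sum‖ ≤ √k := by
    apply Real.le_sqrt_of_sq_le
    refine ht.trans (le_of_eq ?_)
    rw [mul_pow, hsq]; ring
  calc c⁻¹ * _ ≤ c⁻¹ * √k := by gcongr
    _ = 1 / (κ * (1 + √k)) := by
      rw [hc]
      nth_rewrite 2 [← hsq]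
      field_simp

theorem ascFactorial_two_mul_le {M : ℕ} (hM : 4 ≤ M) {k : ℕ} (hk : 1 ≤ k) :
    (2 * M).ascFactorial k ≤ k.factorial * M ^ (k + 1) := by
  obtain rfl | hk2 := hk.eq_or_lt
  · simp [Nat.ascFactorial]; nlinarith
  · induction k, hk2 using Nat.le_induction with
    | base =>
      obtain ⟨m, rfl⟩ := Nat.exists_eq_add_of_le hM
      simp only [Nat.ascFactorial, Nat.factorial, Nat.succ_eq_add_one]
      ring_nf
      nlinarith [Nat.zero_le (m ^ 3), Nat.zero_le (m ^ 2)]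
    | succ k hk2 ih =>
      rw [Nat.ascFactorial_succ, Nat.factorial_succ, pow_succ M (k + 1)]
      have h1 : 2 * M + k ≤ (k + 1) * M := by
        have : 2 ≤ k := hk2
        nlinarith
      calc (2 * M + k) * (2 * M).ascFactorial k
          ≤ ((k + 1) * M) * (k.factorial * M ^ (k + 1)) := Nat.mul_le_mul h1 (ih (by omega))
        _ = _ := by ring

theorem ascFactorial_mul_le {M : ℕ} (hM : 4 ≤ M) {q k : ℕ} (hqk : 9 * q ≤ k) :
    (q * M).ascFactorial k ≤ k.factorial * M ^ k := by
  have h1 : ((q * M).ascFactorial k : ℝ) ≤ (q * M + k : ℝ) ^ k := by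
    have : (q * M).ascFactorial k ≤ (q * M + k) ^ k :=
      (Nat.ascFactorial_le k (Nat.le_succ _)).trans (Nat.ascFactorial_le_pow_add _ _)
    exact_mod_cast this
  have hM' : (4 : ℝ) ≤ M := by exact_mod_cast hM
  have hqk' : (9 * q : ℝ) ≤ k := by exact_mod_cast hqk
  have he := Real.exp_one_lt_d9
  have h2 : (q * M + k : ℝ) * Real.exp 1 ≤ k * M := by
    have h3 : (q * M : ℝ) ≤ k * M / 9 := by nlinarith
    have h4 : (k : ℝ) ≤ k * M / 4 := by nlinarith [(Nat.cast_nonneg k : (0 : ℝ) ≤ k)]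
    have h5 : (0 : ℝ) ≤ k * M := by positivity
    calc (q * M + k : ℝ) * Real.exp 1 ≤ (k * M / 9 + k * M / 4) * 2.72 := by
          gcongr
          linarith
      _ ≤ k * M := by nlinarith
  have h6 : (k : ℝ) ^ k ≤ k.factorial * Real.exp 1 ^ k := by
    have := Real.pow_div_factorial_le_exp (k : ℝ) (Nat.cast_nonneg k) k
    rw [div_le_iff₀ (by positivity)] at this
    rw [← Real.exp_nat_mul, mul_one]
    linarith
  have h7 : (q * M + k : ℝ) ^ k * Real.exp 1 ^ k ≤ k.factorial * M ^ k * Real.exp 1 ^ k := by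
    rw [← mul_pow]
    calc _ ≤ (k * M : ℝ) ^ k := by gcongr
      _ = k ^ k * M ^ k := mul_pow _ _ _
      _ ≤ (k.factorial * Real.exp 1 ^ k) * M ^ k := by gcongr
      _ = _ := by ring
  have h8 := le_of_mul_le_mul_right h7 (by positivity)
  exact_mod_cast h1.trans h8

theorem multichoose_le_of_ascFactorial_le {N M k e : ℕ}
    (h : N.ascFactorial k ≤ k.factorial * M ^ e) : N.multichoose k ≤ M ^ e := by
  rw [Nat.ascFactorial_eq_factorial_mul_choose', ← Nat.multichoose_eq] at h
  exact Nat.le_of_mul_le_mul_left h (Nat.factorial_pos k)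

theorem one_sub_sq_le_cos_sq (y : ℝ) : 1 - y ^ 2 ≤ Real.cos y ^ 2 := by
  have := Real.sin_sq_le_sq (x := y)
  rw [Real.cos_sq']; linarith

theorem exists_sample_size {x : ℝ} (hx : 1 ≤ x) :
    ∃ k q : ℕ, 0 < k ∧ 0 < q ∧ 0 < Real.cos (Real.pi / (4 * q : ℕ)) ∧
      x ≤ (Real.cos (Real.pi / (4 * q : ℕ)) * (1 + √k)) ^ 2 ∧
      ∀ M : ℕ, 4 ≤ M → ((q * M).multichoose k : ℝ) ≤ (M : ℝ) ^ x := by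
  have hπ := Real.pi_pos
  have hcos : ∀ q : ℕ, 0 < q → 0 < Real.cos (Real.pi / (4 * q : ℕ)) := by
    intro q hq
    have hq' : (1 : ℝ) ≤ q := by exact_mod_cast hq
    apply Real.cos_pos_of_mem_Ioo
    constructor
    · have : 0 < Real.pi / (4 * q : ℕ) := by positivity
      linarith
    · rw [div_lt_div_iff₀ (by positivity) (by norm_num)]
      push_cast
      nlinarith
  have hcossq : ∀ q : ℕ, 0 < q → 1 - 0.617 / (q : ℝ) ^ 2 ≤ Real.cos (Real.pi / (4 * q : ℕ)) ^ 2 := by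
    intro q hq
    refine le_trans ?_ (one_sub_sq_le_cos_sq _)
    have hq' : (0 : ℝ) < q := by exact_mod_cast hq
    have hpi2 : Real.pi ^ 2 ≤ 16 * 0.617 := by nlinarith [Real.pi_lt_d4]
    have : (Real.pi / (4 * q : ℕ)) ^ 2 ≤ 0.617 / (q : ℝ) ^ 2 := by
      push_cast
      rw [div_pow, div_le_div_iff₀ (by positivity) (by positivity)]
      nlinarith [sq_nonneg (q : ℝ)]
    linarith
  have hpow : ∀ (M e : ℕ), 4 ≤ M → (e : ℝ) ≤ x → ((M ^ e : ℕ) : ℝ) ≤ (M : ℝ) ^ x := by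
    intro M e hM he
    have : (1 : ℝ) ≤ M := by exact_mod_cast (by omega : 1 ≤ M)
    rw [Nat.cast_pow, ← Real.rpow_natCast]
    exact Real.rpow_le_rpow_of_exponent_le this he
  rcases lt_or_ge x 2 with hx2 | hx2
  · refine ⟨1, 1, one_pos, one_pos, hcos 1 one_pos, ?_, ?_⟩
    · have : Real.pi / (4 * 1 : ℕ) = Real.pi / 4 := by norm_num
      rw [this, Real.cos_pi_div_four]
      have h2 := Real.sq_sqrt (show (0 : ℝ) ≤ 2 by norm_num)
      norm_num
      nlinarith
    · intro M hM
      have := hpow M 1 hM (by simpa using hx)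
      simpa using this
  · obtain ⟨k, hk⟩ : ∃ k, ⌊x⌋₊ = k + 1 :=
      ⟨⌊x⌋₊ - 1, by have : 2 ≤ ⌊x⌋₊ := Nat.le_floor (by exact_mod_cast hx2); omega⟩
    have hk1 : 1 ≤ k := by
      have : 2 ≤ ⌊x⌋₊ := Nat.le_floor (by exact_mod_cast hx2)
      omega
    have hkx : ((k + 1 : ℕ) : ℝ) ≤ x := hk ▸ Nat.floor_le (by linarith)
    have hxk : x ≤ k + 2 := by
      have := (Nat.lt_floor_add_one x).le
      rw [hk] at this; push_cast at this; linarith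
    have hk1' : (1 : ℝ) ≤ k := by exact_mod_cast hk1
    have hr : √(k : ℝ) ^ 2 = k := Real.sq_sqrt (by linarith)
    have hr1 : 1 ≤ √(k : ℝ) := Real.one_le_sqrt.2 hk1'
    rcases lt_or_ge k 18 with hk18 | hk18
    · refine ⟨k, 2, hk1, two_pos, hcos 2 two_pos, ?_, ?_⟩
      · have h1 := hcossq 2 two_pos
        rw [mul_pow]
        have hk18' : (k : ℝ) ≤ 17 := by exact_mod_cast (by omega : k ≤ 17)
        have hr5 : √(k : ℝ) ≤ 5 := by nlinarith
        calc x ≤ k + 2 := hxk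
          _ ≤ (1 - 0.617 / ((2 : ℕ) : ℝ) ^ 2) * (1 + √k) ^ 2 := by
            push_cast
            norm_num
            nlinarith [mul_nonneg (sub_nonneg.2 hr1) (sub_nonneg.2 hr5)]
          _ ≤ _ := by gcongr
      · intro M hM
        refine le_trans ?_ (hpow M (k + 1) hM hkx)
        exact_mod_cast multichoose_le_of_ascFactorial_le (ascFactorial_two_mul_le hM hk1)
    · obtain ⟨q, hq⟩ : ∃ q, k / 9 = q := ⟨_, rfl⟩
      have hq2 : 2 ≤ q := by omega
      refine ⟨k, q, hk1, by omega, hcos q (by omega), ?_, ?_⟩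
      · have h1 := hcossq q (by omega)
        have hq2' : (2 : ℝ) ≤ q := by exact_mod_cast hq2
        have hkq : (k : ℝ) ≤ 9 * q + 8 := by exact_mod_cast (by omega : k ≤ 9 * q + 8)
        have hk18' : (18 : ℝ) ≤ k := by exact_mod_cast hk18
        have hr4 : 4 ≤ √(k : ℝ) := by
          apply Real.le_sqrt_of_sq_le; linarith
        rw [mul_pow]
        have h2 : 0.617 * (1 + √(k : ℝ)) ^ 2 ≤ (2 * √(k : ℝ) - 1) * (q : ℝ) ^ 2 := by
          have h3 : (1 + √(k : ℝ)) ^ 2 ≤ 1.25 * k + 5 := by nlinarith [sq_nonneg (√(k : ℝ) - 4)]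
          calc 0.617 * (1 + √(k : ℝ)) ^ 2 ≤ 7 * (q : ℝ) ^ 2 := by nlinarith
            _ ≤ _ := by gcongr; linarith
        have h4 : 0.617 / (q : ℝ) ^ 2 * (1 + √(k : ℝ)) ^ 2 ≤ 2 * √(k : ℝ) - 1 := by
          rw [div_mul_eq_mul_div, div_le_iff₀ (by positivity)]
          exact h2
        calc x ≤ k + 2 := hxk
          _ ≤ (1 - 0.617 / (q : ℝ) ^ 2) * (1 + √k) ^ 2 := by nlinarith
          _ ≤ _ := by gcongr
      · intro M hM
        refine le_trans ?_ (hpow M k hM (by push_cast at hkx; linarith))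
        exact_mod_cast multichoose_le_of_ascFactorial_le (ascFactorial_mul_le hM (by omega))

/-- The entries of a complex matrix as a vector of a Euclidean space, whose norm is `frob`. -/
noncomputable def vec (m n : ℕ) :
    Matrix (Fin m) (Fin n) ℂ ≃ₗ[ℂ] EuclideanSpace ℂ (Fin m × Fin n) where
  toFun A := WithLp.toLp 2 fun p => A p.1 p.2
  invFun v := fun i j => v (i, j)
  map_add' _ _ := rfl
  map_smul' _ _ := rfl
  left_inv _ := rfl
  right_inv _ := rfl

theorem norm_vec {m n : ℕ} (A : Matrix (Fin m) (Fin n) ℂ) : ‖vec m n A‖ = frob A := by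
  rw [EuclideanSpace.norm_eq, frob, Fintype.sum_prod_type]
  rfl

theorem frob_nonneg {m n : ℕ} (A : Matrix (Fin m) (Fin n) ℂ) : 0 ≤ frob A := Real.sqrt_nonneg _

theorem frob_sq {m n : ℕ} (A : Matrix (Fin m) (Fin n) ℂ) :
    frob A ^ 2 = ∑ i, ∑ j, ‖A i j‖ ^ 2 :=
  Real.sq_sqrt (by positivity)

@[simp] theorem frob_zero {m n : ℕ} : frob (0 : Matrix (Fin m) (Fin n) ℂ) = 0 := by
  simp [frob]

theorem frob_eq_zero {m n : ℕ} {A : Matrix (Fin m) (Fin n) ℂ} (h : frob A = 0) : A = 0 := by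
  rw [← norm_vec, norm_eq_zero] at h
  exact (LinearEquiv.map_eq_zero_iff _).1 h

theorem frob_sub_le {m n : ℕ} (A B D : Matrix (Fin m) (Fin n) ℂ) :
    frob (A - D) ≤ frob (A - B) + frob (B - D) := by
  simp only [← norm_vec, map_sub]
  exact norm_sub_le_norm_sub_add_norm_sub _ _ _

theorem frob_transpose {m n : ℕ} (A : Matrix (Fin m) (Fin n) ℂ) : frob A.transpose = frob A := by
  rw [frob, frob, Finset.sum_comm]
  rfl

/-- The vectorized matrix whose `i`-th row is `y` and whose other rows vanish. -/
noncomputable def rowVec {m n : ℕ} (i : Fin m) (y : Fin n → ℂ) :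
    EuclideanSpace ℂ (Fin m × Fin n) :=
  WithLp.toLp 2 fun p => if p.1 = i then y p.2 else 0

theorem norm_rowVec {m n : ℕ} (i : Fin m) (y : Fin n → ℂ) :
    ‖rowVec i y‖ = √(∑ j, ‖y j‖ ^ 2) := by
  rw [EuclideanSpace.norm_eq, Fintype.sum_prod_type, Finset.sum_eq_single i]
  · simp [rowVec]
  · intro i' _ h
    simp [rowVec, h]
  · simp

theorem vec_mul {m d n : ℕ} (A : Matrix (Fin m) (Fin d) ℂ) (X : Matrix (Fin d) (Fin n) ℂ) :
    vec m n (A * X) = ∑ i, ∑ l, A i l • rowVec i (X l) := by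
  ext p
  simp only [rowVec, WithLp.ofLp_sum, WithLp.ofLp_smul, Finset.sum_apply, Pi.smul_apply,
    smul_eq_mul, mul_ite, mul_zero]
  rw [Finset.sum_eq_single p.1 (fun i _ h => by simp [h.symm]) (by simp)]
  simp only [if_true]
  exact Matrix.mul_apply

theorem sum_norm_mul_le {m d n : ℕ} (A : Matrix (Fin m) (Fin d) ℂ)
    (X : Matrix (Fin d) (Fin n) ℂ) :
    ∑ i, ∑ l, ‖A i l‖ * √(∑ j, ‖X l j‖ ^ 2) ≤ norm21T A * frob X := by
  rw [norm21T, Finset.sum_mul]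
  refine Finset.sum_le_sum fun i _ => ?_
  refine (Real.sum_mul_le_sqrt_mul_sqrt _ _ _).trans (le_of_eq ?_)
  congr 2
  refine Finset.sum_congr rfl fun l _ => Real.sq_sqrt (by positivity)

theorem frob_mul_le_norm21T_mul {m d n : ℕ} (A : Matrix (Fin m) (Fin d) ℂ)
    (X : Matrix (Fin d) (Fin n) ℂ) : frob (A * X) ≤ norm21T A * frob X := by
  rw [← norm_vec, vec_mul]
  refine le_trans ?_ (sum_norm_mul_le A X)
  refine (norm_sum_le _ _).trans (Finset.sum_le_sum fun i _ => ?_)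
  refine (norm_sum_le _ _).trans (Finset.sum_le_sum fun l _ => ?_)
  rw [norm_smul, norm_rowVec]

theorem exists_normalized_row_ge {m d n : ℕ} (hm : 0 < m) (hd : 0 < d)
    (A : Matrix (Fin m) (Fin d) ℂ) (X : Matrix (Fin d) (Fin n) ℂ)
    (w : EuclideanSpace ℂ (Fin m × Fin n)) :
    ∃ (i : Fin m) (l : Fin d), (inner ℂ w (vec m n (A * X))).re ≤ norm21T A * frob X *
      ‖(inner ℂ w (((√(∑ j, ‖X l j‖ ^ 2))⁻¹ : ℂ) • rowVec i (X l)) : ℂ)‖ := by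
  have : Nonempty (Fin m × Fin d) := ⟨⟨⟨0, hm⟩, ⟨0, hd⟩⟩⟩
  set U : Fin m × Fin d → EuclideanSpace ℂ (Fin m × Fin n) :=
    fun p => ((√(∑ j, ‖X p.2 j‖ ^ 2))⁻¹ : ℂ) • rowVec p.1 (X p.2) with hU
  obtain ⟨p, hp⟩ := Finite.exists_max fun p => ‖(inner ℂ w (U p) : ℂ)‖
  refine ⟨p.1, p.2, ?_⟩
  have hrow : ∀ i l, rowVec i (X l) = ((√(∑ j, ‖X l j‖ ^ 2) : ℝ) : ℂ) • U (i, l) := by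
    intro i l
    by_cases h0 : √(∑ j, ‖X l j‖ ^ 2) = 0
    · rw [h0, Complex.ofReal_zero, zero_smul]
      rw [← norm_rowVec i, norm_eq_zero] at h0
      exact h0
    · rw [hU, smul_smul, mul_inv_cancel₀ (by exact_mod_cast h0), one_smul]
  calc (inner ℂ w (vec m n (A * X))).re
      ≤ ‖(inner ℂ w (vec m n (A * X)) : ℂ)‖ := Complex.re_le_norm _
    _ ≤ ∑ i, ∑ l, ‖A i l‖ * √(∑ j, ‖X l j‖ ^ 2) * ‖(inner ℂ w (U (i, l)) : ℂ)‖ := by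
      rw [vec_mul, inner_sum]
      refine (norm_sum_le _ _).trans (Finset.sum_le_sum fun i _ => ?_)
      rw [inner_sum]
      refine (norm_sum_le _ _).trans (Finset.sum_le_sum fun l _ => ?_)
      rw [hrow, inner_smul_right, inner_smul_right, norm_mul, norm_mul, Complex.norm_real,
        Real.norm_of_nonneg (Real.sqrt_nonneg _), mul_assoc]
    _ ≤ ∑ i, ∑ l, ‖A i l‖ * √(∑ j, ‖X l j‖ ^ 2) * ‖(inner ℂ w (U p) : ℂ)‖ := by
      gcongr with i _ l _
      exact hp (i, l)
    _ = (∑ i, ∑ l, ‖A i l‖ * √(∑ j, ‖X l j‖ ^ 2)) * ‖(inner ℂ w (U p) : ℂ)‖ := by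
      simp only [Finset.sum_mul]
    _ ≤ _ := by
      gcongr
      exact sum_norm_mul_le A X

theorem exists_finset_cover_mul {m d n : ℕ} (X : Matrix (Fin d) (Fin n) ℂ) {b ε : ℝ}
    (hb : 0 ≤ b) (hε : 0 < ε) {W : ℕ} (hW : 1 ≤ W) (hm : m ≤ W) (hd : d ≤ W) :
    ∃ C : Finset (Matrix (Fin m) (Fin n) ℂ),
      (∀ A : Matrix (Fin m) (Fin d) ℂ, norm21T A ≤ b → ∃ c ∈ C, frob (A * X - c) ≤ ε) ∧
      (C.card : ℝ) ≤ (4 * (W : ℝ) ^ 2) ^ ((b * frob X) ^ 2 / ε ^ 2) := by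
  classical
  have hX := frob_nonneg X
  have hW1 : (1 : ℝ) ≤ W := by exact_mod_cast hW
  have hbase : (1 : ℝ) ≤ 4 * (W : ℝ) ^ 2 := by nlinarith
  have hsingle : (({0} : Finset (Matrix (Fin m) (Fin n) ℂ)).card : ℝ) ≤
      (4 * (W : ℝ) ^ 2) ^ ((b * frob X) ^ 2 / ε ^ 2) := by
    simpa using Real.one_le_rpow hbase (by positivity)
  rcases lt_or_ge ((b * frob X) ^ 2 / ε ^ 2) 1 with hx | hx
  · refine ⟨{0}, fun A hA => ⟨0, by simp, ?_⟩, hsingle⟩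
    rw [sub_zero]
    refine (frob_mul_le_norm21T_mul A X).trans ((mul_le_mul_of_nonneg_right hA hX).trans ?_)
    rw [div_lt_one (by positivity)] at hx
    exact (abs_le_of_sq_le_sq' hx.le hε.le).2
  rcases Nat.eq_zero_or_pos m with rfl | hm0
  · exact ⟨{0}, fun A _ => ⟨0, by simp, by simp [frob, hε.le]⟩, hsingle⟩
  have hR : 0 < b * frob X := by
    refine lt_of_le_of_ne (by positivity) fun h => ?_
    rw [← h] at hx
    norm_num at hx
  have hd0 : 0 < d := by
    refine Nat.pos_of_ne_zero fun h => ?_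
    subst h
    simp [frob] at hR
  obtain ⟨k, q, hk, hq, hκ, hxκ, hcount⟩ := exists_sample_size hx
  set κ := Real.cos (Real.pi / (4 * q : ℕ)) with hκdef
  set R := b * frob X with hRdef
  set V : Fin m × Fin d × Fin (4 * q) → EuclideanSpace ℂ (Fin m × Fin n) := fun p =>
    Complex.exp ((2 * Real.pi * (p.2.2 : ℕ) / (4 * q : ℕ) : ℝ) * Complex.I) •
      (((√(∑ j, ‖X p.2.1 j‖ ^ 2))⁻¹ : ℂ) • rowVec p.1 (X p.2.1)) with hVdef
  have hV : ∀ p, ‖V p‖ ≤ 1 := by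
    intro p
    rw [hVdef, norm_smul, Complex.norm_exp_ofReal_mul_I, one_mul, norm_smul, norm_rowVec,
      norm_inv, Complex.norm_real, Real.norm_of_nonneg (Real.sqrt_nonneg _)]
    exact inv_mul_le_one
  refine ⟨Finset.univ.image fun t : Sym (Fin m × Fin d × Fin (4 * q)) k =>
    (vec m n).symm ((R : ℂ) • ((κ * (√k + k))⁻¹ : ℂ) • ((t : Multiset _).map V).sum), ?_, ?_⟩
  · intro A hA
    have hsupp : ∀ w, ∃ p, κ * (inner ℂ w ((R⁻¹ : ℂ) • vec m n (A * X))).re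
        ≤ (inner ℂ w (V p)).re := by
      intro w
      obtain ⟨i, l, hil⟩ := exists_normalized_row_ge hm0 hd0 A X w
      obtain ⟨j, hj⟩ := exists_root_of_unity_re_ge (show 0 < 4 * q by omega)
        (inner ℂ w (((√(∑ j, ‖X l j‖ ^ 2))⁻¹ : ℂ) • rowVec i (X l)))
      refine ⟨(i, l, j), ?_⟩
      rw [hVdef, inner_smul_right w (_ • rowVec _ _)]
      refine le_trans ?_ hj
      refine mul_le_mul_of_nonneg_left ?_ hκ.le
      rw [inner_smul_right, ← Complex.ofReal_inv, Complex.re_ofReal_mul, inv_mul_le_iff₀ hR]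
      exact hil.trans (mul_le_mul_of_nonneg_right (mul_le_mul_of_nonneg_right hA hX)
        (norm_nonneg _))
    obtain ⟨t, ht⟩ := exists_sym_norm_sub_le V hV _ hκ hsupp hk
    refine ⟨_, Finset.mem_image_of_mem _ (Finset.mem_univ t), ?_⟩
    rw [← norm_vec, map_sub, LinearEquiv.apply_symm_apply]
    have hRc : (R : ℂ) ≠ 0 := by exact_mod_cast hR.ne'
    have e : vec m n (A * X) - (R : ℂ) • ((κ * (√k + k))⁻¹ : ℂ) • ((t : Multiset _).map V).sum
        = (R : ℂ) • ((R⁻¹ : ℂ) • vec m n (A * X)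
          - ((κ * (√k + k))⁻¹ : ℂ) • ((t : Multiset _).map V).sum) := by
      rw [smul_sub, smul_smul (R : ℂ) (R : ℂ)⁻¹, mul_inv_cancel₀ hRc, one_smul]
    rw [e, norm_smul, Complex.norm_real, Real.norm_of_nonneg hR.le]
    have hpos : 0 < κ * (1 + √(k : ℝ)) := by positivity
    refine (mul_le_mul_of_nonneg_left ht hR.le).trans ?_
    rw [mul_one_div, div_le_iff₀ hpos]
    rw [div_le_iff₀ (by positivity), ← mul_pow] at hxκ
    have := (abs_le_of_sq_le_sq' hxκ (by positivity)).2
    linarith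
  · have h1 : (Finset.univ.image fun t : Sym (Fin m × Fin d × Fin (4 * q)) k =>
        (vec m n).symm ((R : ℂ) • ((κ * (√k + k))⁻¹ : ℂ) • ((t : Multiset _).map V).sum)).card
        ≤ (q * (4 * W ^ 2)).multichoose k := by
      refine Finset.card_image_le.trans ?_
      rw [Finset.card_univ, Sym.card_sym_eq_multichoose, Nat.multichoose_eq, Nat.multichoose_eq]
      refine Nat.choose_le_choose k ?_
      simp only [Fintype.card_prod, Fintype.card_fin]
      have : m * (d * (4 * q)) ≤ q * (4 * W ^ 2) := by
        calc m * (d * (4 * q)) ≤ W * (W * (4 * q)) := by gcongr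
          _ = _ := by ring
      omega
    have h2 := hcount (4 * W ^ 2) (by nlinarith)
    push_cast at h2
    exact (Nat.cast_le.2 h1).trans h2

theorem sqrt_sum_mulVec_le {m d : ℕ} (A : Matrix (Fin m) (Fin d) ℂ) (v : Fin d → ℂ) :
    √(∑ i, ‖A.mulVec v i‖ ^ 2) ≤ specNorm A * √(∑ j, ‖v j‖ ^ 2) := by
  have hbdd : BddAbove {r : ℝ | ∃ v : Fin d → ℂ,
      √(∑ j, ‖v j‖ ^ 2) = 1 ∧ r = √(∑ i, ‖A.mulVec v i‖ ^ 2)} := by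
    refine ⟨norm21T A, ?_⟩
    rintro r ⟨v, hv, rfl⟩
    have h := frob_mul_le_norm21T_mul A (Matrix.replicateCol (Fin 1) v)
    rw [← Matrix.replicateCol_mulVec] at h
    simpa [frob, hv] using h
  set N := √(∑ j, ‖v j‖ ^ 2) with hN
  have hN0 : 0 ≤ N := Real.sqrt_nonneg _
  have hscale : ∀ {l : ℕ} (c : ℝ) (u : Fin l → ℂ), 0 ≤ c →
      √(∑ j, ‖((c : ℂ) • u) j‖ ^ 2) = c * √(∑ j, ‖u j‖ ^ 2) := by
    intro l c u hc
    simp only [Pi.smul_apply, norm_smul, Complex.norm_real, Real.norm_of_nonneg hc, mul_pow,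
      ← Finset.mul_sum]
    rw [Real.sqrt_mul (sq_nonneg c), Real.sqrt_sq hc]
  rcases hN0.eq_or_lt with h0 | hpos
  · have hsum : ∑ j, ‖v j‖ ^ 2 = 0 := by
      have := Real.sqrt_eq_zero (show 0 ≤ ∑ j, ‖v j‖ ^ 2 by positivity)
      exact this.1 h0.symm
    have hv : v = 0 := by
      ext j
      have := (Finset.sum_eq_zero_iff_of_nonneg (fun j _ => by positivity)).1 hsum j
        (Finset.mem_univ j)
      simpa using this
    rw [← h0, hv]
    simp
  · have h1 : √(∑ i, ‖A.mulVec (((N⁻¹ : ℝ) : ℂ) • v) i‖ ^ 2) ≤ specNorm A := by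
      refine le_csSup hbdd ⟨_, ?_, rfl⟩
      rw [hscale _ _ (inv_nonneg.2 hN0), ← hN, inv_mul_cancel₀ hpos.ne']
    rw [Matrix.mulVec_smul, hscale _ _ (inv_nonneg.2 hN0), inv_mul_le_iff₀ hpos] at h1
    linarith

theorem frob_mul_le_specNorm_mul {m d n : ℕ} (A : Matrix (Fin m) (Fin d) ℂ)
    (X : Matrix (Fin d) (Fin n) ℂ) {s : ℝ} (hs : 0 ≤ s) (hA : specNorm A ≤ s) :
    frob (A * X) ≤ s * frob X := by
  refine (sq_le_sq₀ (frob_nonneg _) (mul_nonneg hs (frob_nonneg _))).1 ?_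
  rw [mul_pow, ← frob_transpose (A * X), ← frob_transpose X, frob_sq, frob_sq, Finset.mul_sum]
  refine Finset.sum_le_sum fun j _ => ?_
  have h := (sqrt_sum_mulVec_le A fun l => X l j).trans
    (mul_le_mul_of_nonneg_right hA (Real.sqrt_nonneg _))
  have h2 := pow_le_pow_left₀ (Real.sqrt_nonneg _) h 2
  rw [mul_pow, Real.sq_sqrt (by positivity), Real.sq_sqrt (by positivity)] at h2
  exact h2

/-- Every point can be moved into the ball of radius `r` without increasing its distance to any
point of this ball. -/
theorem exists_clip {E : Type*} [NormedAddCommGroup E] [InnerProductSpace ℂ E] {r : ℝ}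
    (hr : 0 ≤ r) (y : E) : ∃ z : E, ‖z‖ ≤ r ∧ ∀ x : E, ‖x‖ ≤ r → ‖x - z‖ ≤ ‖x - y‖ := by
  rcases le_or_gt ‖y‖ r with hy | hy
  · exact ⟨y, hy, fun _ _ => le_rfl⟩
  have hy0 : 0 < ‖y‖ := hr.trans_lt hy
  set c := r / ‖y‖ with hc
  have hc0 : 0 ≤ c := by positivity
  have hc1 : c ≤ 1 := (div_le_one hy0).2 hy.le
  have hcy : c * ‖y‖ = r := div_mul_cancel₀ r hy0.ne'
  have hz : ‖(c : ℂ) • y‖ = r := by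
    rw [norm_smul, Complex.norm_real, Real.norm_of_nonneg hc0, hcy]
  refine ⟨(c : ℂ) • y, hz.le, fun x hx => ?_⟩
  refine (sq_le_sq₀ (norm_nonneg _) (norm_nonneg _)).1 ?_
  rw [norm_sub_sq (𝕜 := ℂ), norm_sub_sq (𝕜 := ℂ), hz, inner_smul_right, RCLike.re_to_complex,
    RCLike.re_to_complex, Complex.re_ofReal_mul]
  have hin : (inner ℂ x y).re ≤ r * ‖y‖ :=
    (Complex.re_le_norm _).trans ((norm_inner_le_norm x y).trans (by gcongr))
  have h1 : (1 - c) * (inner ℂ x y).re ≤ (1 - c) * (r * ‖y‖) :=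
    mul_le_mul_of_nonneg_left hin (by linarith)
  have h2 : c * (r * ‖y‖) = r ^ 2 := by rw [mul_left_comm, hcy, sq]
  nlinarith [sq_nonneg (‖y‖ - r)]

theorem exists_frob_clip {m n : ℕ} {r : ℝ} (hr : 0 ≤ r) (Y : Matrix (Fin m) (Fin n) ℂ) :
    ∃ Y' : Matrix (Fin m) (Fin n) ℂ, frob Y' ≤ r ∧
      ∀ X : Matrix (Fin m) (Fin n) ℂ, frob X ≤ r → frob (X - Y') ≤ frob (X - Y) := by
  obtain ⟨z, hz, h⟩ := exists_clip hr (vec m n Y)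
  refine ⟨(vec m n).symm z, ?_, fun X hX => ?_⟩
  · rwa [← norm_vec, LinearEquiv.apply_symm_apply]
  · rw [← norm_vec, ← norm_vec, map_sub, map_sub, LinearEquiv.apply_symm_apply]
    exact h _ ((norm_vec X).trans_le hX)

theorem exists_finset_cover_matNetOut (n : ℕ) (dims : ℕ → ℕ)
    (σ : ∀ i : ℕ, Matrix (Fin (dims (i + 1))) (Fin n) ℂ → Matrix (Fin (dims (i + 1))) (Fin n) ℂ)
    (ρ : ℕ → ℝ) (hσ0 : ∀ i, σ i 0 = 0)
    (hσlip : ∀ i (X Y : Matrix (Fin (dims (i + 1))) (Fin n) ℂ),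
      frob (σ i X - σ i Y) ≤ ρ i * frob (X - Y))
    (s b t : ℕ → ℝ) (hs : ∀ i, 0 < s i) (hb : ∀ i, 0 < b i) (ht : ∀ i, 0 < t i)
    (X : Matrix (Fin (dims 0)) (Fin n) ℂ) {W : ℕ} (hW : 1 ≤ W) (k : ℕ)
    (hdims : ∀ i ≤ k, dims i ≤ W) (hρ : ∀ i < k, 0 < ρ i) :
    ∃ C : Finset (Matrix (Fin (dims k)) (Fin n) ℂ),
      (∀ c ∈ C, frob c ≤ frob X * ∏ j ∈ Finset.range k, s j * ρ j) ∧
      (∀ A : ∀ i : ℕ, Matrix (Fin (dims (i + 1))) (Fin (dims i)) ℂ,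
        (∀ i < k, specNorm (A i) ≤ s i ∧ norm21T (A i) ≤ b i) →
        ∃ c ∈ C, frob (matNetOut dims n σ A k X - c) ≤
          (∏ j ∈ Finset.range k, s j * ρ j) * ∑ i ∈ Finset.range k, t i) ∧
      (C.card : ℝ) ≤ (4 * (W : ℝ) ^ 2) ^
        (frob X ^ 2 * ∑ i ∈ Finset.range k, (b i / s i) ^ 2 / t i ^ 2) := by
  classical
  have hW1 : (1 : ℝ) ≤ W := by exact_mod_cast hW
  have hbase : (1 : ℝ) ≤ 4 * (W : ℝ) ^ 2 := by nlinarith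
  induction k with
  | zero =>
    refine ⟨{X}, by simp, fun A _ => ⟨X, by simp, by simp [matNetOut]⟩, by simp⟩
  | succ k ih =>
    obtain ⟨C, hCnorm, hCcov, hCcard⟩ :=
      ih (fun i hi => hdims i (by omega)) (fun i hi => hρ i (by omega))
    set P := ∏ j ∈ Finset.range k, s j * ρ j with hP
    have hP0 : 0 < P := Finset.prod_pos fun j hj =>
      mul_pos (hs j) (hρ j (by have := Finset.mem_range.1 hj; omega))
    have hρk : 0 < ρ k := hρ k (by omega)
    have hsk := hs k
    have htk := ht k
    have hX := frob_nonneg X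
    have he : 0 < s k * P * t k := by positivity
    choose D hDcov hDcard using fun c : Matrix (Fin (dims k)) (Fin n) ℂ =>
      exists_finset_cover_mul c (hb k).le he hW (hdims (k + 1) le_rfl) (hdims k (by omega))
    choose clip hclip_le hclip using fun Y : Matrix (Fin (dims (k + 1))) (Fin n) ℂ =>
      exists_frob_clip (by positivity : 0 ≤ s k * (frob X * P)) Y
    refine ⟨C.biUnion fun c => (D c).image fun Y => σ k (clip Y), ?_, ?_, ?_⟩
    · intro c hc
      simp only [Finset.mem_biUnion, Finset.mem_image] at hc
      obtain ⟨_, _, Y, _, rfl⟩ := hc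
      have h := hσlip k (clip Y) 0
      rw [hσ0, sub_zero, sub_zero] at h
      rw [Finset.prod_range_succ, ← hP]
      calc _ ≤ ρ k * (s k * (frob X * P)) :=
            h.trans (mul_le_mul_of_nonneg_left (hclip_le Y) hρk.le)
        _ = _ := by ring
    · intro A hA
      obtain ⟨c, hc, hcX⟩ := hCcov A fun i hi => hA i (by omega)
      obtain ⟨hAs, hAb⟩ := hA k (by omega)
      obtain ⟨Y, hY, hYc⟩ := hDcov c (A k) hAb
      refine ⟨σ k (clip Y), ?_, ?_⟩
      · simp only [Finset.mem_biUnion, Finset.mem_image]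
        exact ⟨c, hc, Y, hY, rfl⟩
      · have hAc : frob (A k * c) ≤ s k * (frob X * P) :=
          (frob_mul_le_specNorm_mul _ _ hsk.le hAs).trans
            (mul_le_mul_of_nonneg_left (hCnorm c hc) hsk.le)
        have h1 := (hclip Y _ hAc).trans hYc
        have h2 : frob (A k * matNetOut dims n σ A k X - A k * c)
            ≤ s k * (P * ∑ i ∈ Finset.range k, t i) := by
          rw [← Matrix.mul_sub]
          exact (frob_mul_le_specNorm_mul _ _ hsk.le hAs).trans
            (mul_le_mul_of_nonneg_left hcX hsk.le)
        rw [Finset.prod_range_succ, Finset.sum_range_succ, ← hP]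
        calc _ ≤ ρ k * frob (A k * matNetOut dims n σ A k X - clip Y) := hσlip k _ _
          _ ≤ ρ k * (s k * (P * ∑ i ∈ Finset.range k, t i) + s k * P * t k) := by
            gcongr
            exact (frob_sub_le _ (A k * c) _).trans (add_le_add h2 h1)
          _ = _ := by ring
    · have hcard : ∀ c ∈ C, (((D c).image fun Y => σ k (clip Y)).card : ℝ) ≤
          (4 * (W : ℝ) ^ 2) ^ (frob X ^ 2 * ((b k / s k) ^ 2 / t k ^ 2)) := by
        intro c hc
        refine (Nat.cast_le.2 Finset.card_image_le).trans ((hDcard c).trans ?_)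
        refine Real.rpow_le_rpow_of_exponent_le hbase ?_
        have hbk := hb k
        have hc0 := frob_nonneg c
        calc (b k * frob c) ^ 2 / (s k * P * t k) ^ 2
            ≤ (b k * (frob X * P)) ^ 2 / (s k * P * t k) ^ 2 := by
              gcongr
              exact hCnorm c hc
          _ = _ := by field_simp
      rw [Finset.sum_range_succ, mul_add, Real.rpow_add (by linarith)]
      calc _ ≤ ∑ c ∈ C, (((D c).image fun Y => σ k (clip Y)).card : ℝ) := by
            exact_mod_cast Finset.card_biUnion_le
        _ ≤ ∑ _c ∈ C, (4 * (W : ℝ) ^ 2) ^ (frob X ^ 2 * ((b k / s k) ^ 2 / t k ^ 2)) :=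
            Finset.sum_le_sum hcard
        _ = C.card * (4 * (W : ℝ) ^ 2) ^ (frob X ^ 2 * ((b k / s k) ^ 2 / t k ^ 2)) := by
            rw [Finset.sum_const, nsmul_eq_mul]
        _ ≤ _ := by gcongr

theorem matNetOut_eq_zero_of_le {dims : ℕ → ℕ} {n : ℕ}
    {σ : ∀ i : ℕ, Matrix (Fin (dims (i + 1))) (Fin n) ℂ → Matrix (Fin (dims (i + 1))) (Fin n) ℂ}
    (hσ0 : ∀ i, σ i 0 = 0) (A : ∀ i : ℕ, Matrix (Fin (dims (i + 1))) (Fin (dims i)) ℂ)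
    (X : Matrix (Fin (dims 0)) (Fin n) ℂ) {i L : ℕ} (hi : i ≤ L)
    (h : matNetOut dims n σ A i X = 0) : matNetOut dims n σ A L X = 0 := by
  induction L, hi using Nat.le_induction with
  | base => exact h
  | succ k _ ih =>
    change σ k (A k * matNetOut dims n σ A k X) = 0
    rw [ih, Matrix.mul_zero, hσ0]

theorem coveringNumber_le_card {E : Type*} {d : E → E → ℝ} {S : Set E} {ε : ℝ} {C : Finset E}
    (h : ∀ x ∈ S, ∃ c ∈ C, d x c ≤ ε) : coveringNumber d S ε ≤ C.card :=
  iInf₂_le C h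

/-- **Lemma 2 (covering bound for the whole network).** -/
theorem cvnn_covering_bound
    (n L : ℕ) (hL : 0 < L)
    (dims : ℕ → ℕ)
    (σ : ∀ i : ℕ, Matrix (Fin (dims (i + 1))) (Fin n) ℂ → Matrix (Fin (dims (i + 1))) (Fin n) ℂ)
    (ρ : ℕ → ℝ)
    (hσ0 : ∀ i, σ i 0 = 0)
    (hσlip : ∀ i (X Y : Matrix (Fin (dims (i + 1))) (Fin n) ℂ),
      frob (σ i X - σ i Y) ≤ ρ i * frob (X - Y))
    (s b : ℕ → ℝ) (hs : ∀ i, 0 < s i) (hb : ∀ i, 0 < b i)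
    (Z : Matrix (Fin n) (Fin (dims 0)) ℂ)
    (W : ℕ) (hW : W = (Finset.range (L + 1)).sup dims)
    (ε : ℝ) (hε : 0 < ε) :
    coveringNumber frobDist
        {X : Matrix (Fin (dims L)) (Fin n) ℂ |
          ∃ A : ∀ i : ℕ, Matrix (Fin (dims (i + 1))) (Fin (dims i)) ℂ,
            (∀ i < L, specNorm (A i) ≤ s i ∧ norm21T (A i) ≤ b i) ∧
            X = matNetOut dims n σ A L Z.transpose} ε
      ≤ ENNReal.ofReal
          (Real.exp ((frob Z ^ 2 * Real.log (4 * (W : ℝ) ^ 2) / ε ^ 2)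
            * (∏ j ∈ Finset.range L, s j ^ 2 * ρ j ^ 2)
            * (∑ i ∈ Finset.range L, (b i / s i) ^ ((2 : ℝ) / 3)) ^ 3)) := by
  set B := (frob Z ^ 2 * Real.log (4 * (W : ℝ) ^ 2) / ε ^ 2)
    * (∏ j ∈ Finset.range L, s j ^ 2 * ρ j ^ 2)
    * (∑ i ∈ Finset.range L, (b i / s i) ^ ((2 : ℝ) / 3)) ^ 3 with hB
  have hα : ∀ i, 0 < (b i / s i) ^ ((2 : ℝ) / 3) :=
    fun i => Real.rpow_pos_of_pos (div_pos (hb i) (hs i)) _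
  have hsum : 0 < ∑ i ∈ Finset.range L, (b i / s i) ^ ((2 : ℝ) / 3) :=
    Finset.sum_pos (fun i _ => hα i) ⟨0, Finset.mem_range.2 hL⟩
  have hlog : 0 ≤ Real.log (4 * (W : ℝ) ^ 2) := by
    rcases Nat.eq_zero_or_pos W with h | h
    · simp [h]
    · have : (1 : ℝ) ≤ W := by exact_mod_cast h
      exact Real.log_nonneg (by nlinarith)
  have hB0 : 0 ≤ B := by positivity
  have hdims : ∀ i ≤ L, dims i ≤ W := fun i hi => by
    rw [hW]
    exact Finset.le_sup (f := dims) (Finset.mem_range.2 (by omega))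
  have htrivial : (∀ A, matNetOut dims n σ A L Z.transpose = 0) →
      coveringNumber frobDist {X : Matrix (Fin (dims L)) (Fin n) ℂ |
          ∃ A : ∀ i : ℕ, Matrix (Fin (dims (i + 1))) (Fin (dims i)) ℂ,
            (∀ i < L, specNorm (A i) ≤ s i ∧ norm21T (A i) ≤ b i) ∧
            X = matNetOut dims n σ A L Z.transpose} ε ≤ ENNReal.ofReal (Real.exp B) := by
    intro h
    refine (coveringNumber_le_card (C := {0}) ?_).trans ?_
    · rintro x ⟨A, -, rfl⟩
      exact ⟨0, by simp, by simp [h A, frobDist, hε.le]⟩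
    · rw [Finset.card_singleton, Nat.cast_one, ENNReal.one_le_ofReal]
      exact Real.one_le_exp hB0
  by_cases hρ : ∀ i < L, 0 < ρ i
  swap
  · push Not at hρ
    obtain ⟨i, hi, hρi⟩ := hρ
    refine htrivial fun A => matNetOut_eq_zero_of_le hσ0 A _ (Nat.succ_le_of_lt hi) ?_
    refine frob_eq_zero (le_antisymm ?_ (frob_nonneg _))
    have h := hσlip i (A i * matNetOut dims n σ A i Z.transpose) 0
    rw [hσ0, sub_zero, sub_zero] at h
    exact h.trans (mul_nonpos_of_nonpos_of_nonneg hρi (frob_nonneg _))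
  rcases Nat.eq_zero_or_pos W with hW0 | hW0
  · have hL0 : dims L = 0 := Nat.le_zero.1 (hW0 ▸ hdims L le_rfl)
    have : IsEmpty (Fin (dims L)) := by rw [hL0]; infer_instance
    exact htrivial fun A => Subsingleton.elim _ _
  set a := ∑ i ∈ Finset.range L, (b i / s i) ^ ((2 : ℝ) / 3) with ha
  set P := ∏ j ∈ Finset.range L, s j * ρ j with hP
  have hP0 : 0 < P :=
    Finset.prod_pos fun j hj => mul_pos (hs j) (hρ j (Finset.mem_range.1 hj))
  obtain ⟨C, -, hcov, hcard⟩ := exists_finset_cover_matNetOut n dims σ ρ hσ0 hσlip s b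
    (fun i => ε / (P * a) * (b i / s i) ^ ((2 : ℝ) / 3)) hs hb
    (fun i => mul_pos (by positivity) (hα i)) Z.transpose hW0 L hdims hρ
  refine (coveringNumber_le_card (C := C) ?_).trans ?_
  · rintro x ⟨A, hA, rfl⟩
    obtain ⟨c, hc, hle⟩ := hcov A hA
    refine ⟨c, hc, hle.trans (le_of_eq ?_)⟩
    rw [← Finset.mul_sum, ← hP, ← ha]
    field_simp
  · rw [← ENNReal.ofReal_natCast]
    refine ENNReal.ofReal_le_ofReal (hcard.trans (le_of_eq ?_))
    have hW1 : (0 : ℝ) < W := by exact_mod_cast hW0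
    rw [Real.rpow_def_of_pos (by positivity), frob_transpose]
    congr 1
    have hterm : ∀ i, (b i / s i) ^ 2 / (ε / (P * a) * (b i / s i) ^ ((2 : ℝ) / 3)) ^ 2
        = (P * a / ε) ^ 2 * (b i / s i) ^ ((2 : ℝ) / 3) := by
      intro i
      have hpos := div_pos (hb i) (hs i)
      have hcube : (b i / s i) ^ 2 = ((b i / s i) ^ ((2 : ℝ) / 3)) ^ 3 := by
        rw [← Real.rpow_natCast, ← Real.rpow_natCast, ← Real.rpow_mul hpos.le]
        norm_num
      have := hα i
      rw [hcube]
      field_simp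
    simp only [hterm]
    rw [← Finset.mul_sum, ← ha, hB]
    have hPsq : ∏ j ∈ Finset.range L, s j ^ 2 * ρ j ^ 2 = P ^ 2 := by
      rw [hP, ← Finset.prod_pow]
      exact Finset.prod_congr rfl fun j _ => (mul_pow _ _ _).symm
    rw [hPsq]
    field_simp
end

section
/- (Maurey sparsification) Let H be a Hilbert space with norm ‖·‖, and let f ∈ H be of the form f = Σ_{i=1}^n α_i g_i with g_i ∈ H, α_i > 0, and α := Σ_{i=1}^n α_i ≠ 0. Then for any positive integer k, there exist non-negative integers k_1,...,k_n with Σ_{i=1}^n k_i = k such that ‖ f − (α/k) Σ_{i=1}^n k_i g_i ‖² ≤ (α/k) Σ_{i=1}^n α_i ‖g_i‖² ≤ (α²/k) max_i ‖g_i‖². -/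
open Finset

/-- Expanding the square around the barycentre of a weighted family: the cross term vanishes. -/
theorem sum_mul_norm_add_sq_of_sum_smul_eq_zero {𝕜 H ι : Type*} [RCLike 𝕜]
    [NormedAddCommGroup H] [InnerProductSpace 𝕜 H] [Fintype ι] (w : ι → ℝ) (h : ι → H)
    (hw : ∑ i, (w i : 𝕜) • h i = 0) (x : H) :
    ∑ i, w i * ‖x + h i‖ ^ 2 = (∑ i, w i) * ‖x‖ ^ 2 + ∑ i, w i * ‖h i‖ ^ 2 := by
  have cross : ∑ i, w i * RCLike.re (inner 𝕜 x (h i)) = 0 := by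
    have := congrArg (fun y => RCLike.re (inner 𝕜 x y)) hw
    simpa [inner_sum, inner_smul_right, RCLike.re_ofReal_mul] using this
  have expand : ∀ i, w i * ‖x + h i‖ ^ 2 =
      w i * ‖x‖ ^ 2 + 2 * (w i * RCLike.re (inner 𝕜 x (h i))) + w i * ‖h i‖ ^ 2 := fun i => by
    rw [norm_add_sq (𝕜 := 𝕜)]
    ring
  simp_rw [expand, sum_add_distrib, ← mul_sum, cross, ← sum_mul]
  ring

/-- Greedy selection: sums of `k` vectors drawn from a weighted family with barycentre zero
can be kept as small as they are on average. -/
theorem exists_sum_eq_norm_sum_smul_sq_le {𝕜 H ι : Type*} [RCLike 𝕜]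
    [NormedAddCommGroup H] [InnerProductSpace 𝕜 H] [Fintype ι] (w : ι → ℝ) (h : ι → H)
    (hw_pos : 0 < ∑ i, w i) (hw_nonneg : ∀ i, 0 ≤ w i)
    (hw : ∑ i, (w i : 𝕜) • h i = 0) (k : ℕ) :
    ∃ m : ι → ℕ, ∑ i, m i = k ∧
      (∑ i, w i) * ‖∑ i, (m i : 𝕜) • h i‖ ^ 2 ≤ k * ∑ i, w i * ‖h i‖ ^ 2 := by
  classical
  induction k with
  | zero => exact ⟨0, by simp, by simp⟩
  | succ k ih =>
    obtain ⟨m, hm, hle⟩ := ih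
    set x := ∑ i, (m i : 𝕜) • h i with hx
    obtain ⟨j, hj⟩ : ∃ j, (∑ i, w i) * ‖x + h j‖ ^ 2 ≤
        (∑ i, w i) * ‖x‖ ^ 2 + ∑ i, w i * ‖h i‖ ^ 2 := by
      by_contra! hlt
      obtain ⟨i₀, -, hi₀⟩ := exists_lt_of_sum_lt (s := univ) (f := fun _ : ι => (0 : ℝ)) (g := w)
        (by simpa using hw_pos)
      have key : ∑ i, w i * ((∑ i, w i) * ‖x‖ ^ 2 + ∑ i, w i * ‖h i‖ ^ 2) <
          ∑ i, w i * ((∑ i, w i) * ‖x + h i‖ ^ 2) :=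
        sum_lt_sum (fun i _ => mul_le_mul_of_nonneg_left (hlt i).le (hw_nonneg i))
          ⟨i₀, mem_univ _, mul_lt_mul_of_pos_left (hlt i₀) hi₀⟩
      rw [← sum_mul, ← sum_mul_norm_add_sq_of_sum_smul_eq_zero w h hw x, mul_sum] at key
      simp_rw [mul_left_comm] at key
      exact lt_irrefl _ key
    refine ⟨m + Pi.single j 1, by simp [sum_add_distrib, hm], ?_⟩
    have hsum : ∑ i, (((m + Pi.single j 1 : ι → ℕ) i : ℕ) : 𝕜) • h i = x + h j := by
      simp [add_smul, sum_add_distrib, hx, Pi.single_apply]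
    rw [hsum]
    push_cast
    linarith

/-- **Maurey's sparsification lemma.** In a (real or complex) Hilbert space, if
`f = Σ_{i=1}^n α_i g_i` with `α_i > 0` and `α = Σ α_i ≠ 0`, then for every positive
integer `k` there exist nonnegative integers `k_1, …, k_n` summing to `k` with
`‖f − (α/k) Σ k_i g_i‖² ≤ (α/k) Σ α_i ‖g_i‖² ≤ (α²/k) max_i ‖g_i‖²`. -/
theorem maurey_sparsification
    {𝕜 : Type*} [RCLike 𝕜] {H : Type*} [NormedAddCommGroup H] [InnerProductSpace 𝕜 H]
    (n : ℕ) (g : Fin n → H) (α : Fin n → ℝ) (hα : ∀ i, 0 < α i)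
    (f : H) (hf : f = ∑ i, ((α i : 𝕜)) • g i)
    (hαsum : (∑ i, α i) ≠ 0)
    (k : ℕ) (hk : 0 < k) :
    ∃ ks : Fin n → ℕ, (∑ i, ks i) = k ∧
      ‖f - (((∑ i, α i) / k : ℝ) : 𝕜) • ∑ i, (ks i : 𝕜) • g i‖ ^ 2
          ≤ ((∑ i, α i) / k) * ∑ i, α i * ‖g i‖ ^ 2 ∧
      ((∑ i, α i) / k) * ∑ i, α i * ‖g i‖ ^ 2
          ≤ ((∑ i, α i) ^ 2 / k) * ⨆ i, ‖g i‖ ^ 2 := by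
  have hA : 0 < ∑ i, α i := lt_of_le_of_ne (sum_nonneg fun i _ => (hα i).le) hαsum.symm
  have hk' : (0 : ℝ) < k := Nat.cast_pos.2 hk
  set A := ∑ i, α i with hA_def
  set h : Fin n → H := fun i => (A : 𝕜) • g i - f with h_def
  have hA𝕜 : ∑ i, (α i : 𝕜) = A := by simp [hA_def]
  have hh : ∑ i, (α i : 𝕜) • h i = 0 := by
    simp_rw [h_def, smul_sub, sum_sub_distrib, ← sum_smul, hA𝕜, smul_comm _ (A : 𝕜),
      ← smul_sum, ← hf, sub_self]
  obtain ⟨m, hm, hle⟩ := exists_sum_eq_norm_sum_smul_sq_le α h hA (fun i => (hα i).le) hh k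
  have variance_le : ∑ i, α i * ‖h i‖ ^ 2 ≤ A ^ 2 * ∑ i, α i * ‖g i‖ ^ 2 := by
    have hf_add := sum_mul_norm_add_sq_of_sum_smul_eq_zero α h hh f
    have hsq : ∀ i, α i * ‖f + h i‖ ^ 2 = A ^ 2 * (α i * ‖g i‖ ^ 2) := fun i => by
      rw [h_def, add_sub_cancel, norm_smul, RCLike.norm_ofReal, mul_pow, sq_abs]
      ring
    simp_rw [hsq, ← mul_sum] at hf_add
    nlinarith [mul_nonneg hA.le (sq_nonneg ‖f‖)]
  refine ⟨m, hm, ?_, ?_⟩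
  · have hsum : ∑ i, (m i : 𝕜) • h i =
        -(k : 𝕜) • (f - ((A / k : ℝ) : 𝕜) • ∑ i, (m i : 𝕜) • g i) := by
      have hk𝕜 : (k : 𝕜) ≠ 0 := Nat.cast_ne_zero.2 hk.ne'
      have hm𝕜 : ∑ i, (m i : 𝕜) = k := by rw [← hm]; push_cast; rfl
      have hmul : (k : 𝕜) * ((A / k : ℝ) : 𝕜) = A := by
        push_cast
        field_simp
      simp_rw [h_def, smul_sub, sum_sub_distrib, ← sum_smul, hm𝕜, smul_comm _ (A : 𝕜),
        ← smul_sum, neg_smul, smul_smul, hmul]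
      abel
    rw [hsum, norm_smul, norm_neg, RCLike.norm_natCast, mul_pow] at hle
    have hle' := hle.trans (mul_le_mul_of_nonneg_left variance_le hk'.le)
    rw [div_mul_eq_mul_div, le_div_iff₀ hk']
    refine le_of_mul_le_mul_left ?_ (mul_pos hA hk')
    linarith
  · have hsup : ∑ i, α i * ‖g i‖ ^ 2 ≤ A * ⨆ i, ‖g i‖ ^ 2 := by
      rw [hA_def, sum_mul]
      exact sum_le_sum fun i _ => mul_le_mul_of_nonneg_left
        (le_ciSup (f := fun i => ‖g i‖ ^ 2) (Set.finite_range _).bddAbove i) (hα i).le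
    calc A / k * ∑ i, α i * ‖g i‖ ^ 2 ≤ A / k * (A * ⨆ i, ‖g i‖ ^ 2) := by gcongr
      _ = A ^ 2 / k * ⨆ i, ‖g i‖ ^ 2 := by ring
end
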